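/- Let M be a 3-quasi-Sasakian manifold of rank 4l+3. Then the Ricci tensor of M is given by Ric(X,Y) = (c²/2)(2l+1) g(X,Y) for X, Y ∈ Γ(E^{4l+3}) and Ric(X,Y) = 0 whenever X or Y belongs to Γ(E^{4m}). In particular, M has positive constant scalar curvature equal to (c²/2)(2l+1)(4l+3). -/

import Mathlib

/-!
An abstract (Lie–Rinehart style) algebraic model of the differential geometry of
almost contact metric 3-structures: `F` plays the role of the algebra of smooth
functions on a manifold `M` of dimension `4n+3`, and `V` plays the role of the
`F`-module of smooth vector fields, acting on `F` by derivations and carrying a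
Lie bracket, a Riemannian metric `g`, and three almost contact metric structures
`(φ_α, ξ_α, η_α, g)`.
-/

noncomputable section

namespace QS3

/-- Cyclic (= even) permutations of `{0,1,2}`, modelling even permutations of `{1,2,3}`. -/
def Cyclic (a b c : Fin 3) : Prop :=
  (a, b, c) = (0, 1, 2) ∨ (a, b, c) = (1, 2, 0) ∨ (a, b, c) = (2, 0, 1)

/-- The algebraic model of the smooth structure of a manifold: an `ℝ`-algebra `F`
of smooth functions and an `F`-module `V` of vector fields acting on `F` by
derivations and carrying the Lie bracket of vector fields. -/
class SmoothSetting (F : Type) (V : Type) [CommRing F] [Algebra ℝ F]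
    [AddCommGroup V] [Module F V] where
  act : V → F → F
  bracket : V → V → V
  act_add : ∀ (X : V) (f₁ f₂ : F), act X (f₁ + f₂) = act X f₁ + act X f₂
  act_mul : ∀ (X : V) (f₁ f₂ : F), act X (f₁ * f₂) = act X f₁ * f₂ + f₁ * act X f₂
  act_const : ∀ (X : V) (r : ℝ), act X (algebraMap ℝ F r) = 0
  act_addLeft : ∀ (X Y : V) (f : F), act (X + Y) f = act X f + act Y f
  act_smulLeft : ∀ (f : F) (X : V) (h : F), act (f • X) h = f * act X h
  bracket_antisymm : ∀ X Y : V, bracket X Y = -bracket Y X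
  bracket_addLeft : ∀ X Y Z : V, bracket (X + Y) Z = bracket X Z + bracket Y Z
  bracket_act : ∀ (X Y : V) (f : F),
    act (bracket X Y) f = act X (act Y f) - act Y (act X f)
  bracket_smulRight : ∀ (X : V) (f : F) (Y : V),
    bracket X (f • Y) = f • bracket X Y + act X f • Y
  jacobi : ∀ X Y Z : V,
    bracket X (bracket Y Z) + bracket Y (bracket Z X) + bracket Z (bracket X Y) = 0

section d

variable (F V : Type) [CommRing F] [Algebra ℝ F] [AddCommGroup V] [Module F V]
  [SmoothSetting F V]

/-- The action of a vector field on a function (directional derivative). -/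
def der (X : V) (f : F) : F := SmoothSetting.act X f

/-- The Lie bracket of vector fields. -/
def lie (X Y : V) : V := SmoothSetting.bracket F X Y

/-- Exterior differential of a 1-form (with the `1/2` normalization convention,
so that `2 dθ(X,Y) = X θ(Y) - Y θ(X) - θ([X,Y])`). -/
def dOne (θ : V → F) (X Y : V) : F :=
  (2 : ℝ)⁻¹ • (der F V X (θ Y) - der F V Y (θ X) - θ (lie F V X Y))

/-- Exterior differential of a 2-form (with the `1/3` normalization convention). -/
def dTwo (ω : V → V → F) (X Y Z : V) : F :=
  (3 : ℝ)⁻¹ • (der F V X (ω Y Z) + der F V Y (ω Z X) + der F V Z (ω X Y)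
    - ω (lie F V X Y) Z - ω (lie F V Y Z) X - ω (lie F V Z X) Y)

end d

/-- An almost contact metric 3-structure on a manifold of dimension `4n+3`:
three almost contact metric structures `(φ_α, ξ_α, η_α, g)` satisfying the
quaternionic-type relations, together with a (local) orthonormal frame. -/
class ACM3 (F V : Type) [CommRing F] [Algebra ℝ F] [AddCommGroup V] [Module F V]
    [SmoothSetting F V] where
  n : ℕ
  g : V → V → F
  phi : Fin 3 → V → V
  xi : Fin 3 → V
  eta : Fin 3 → V → F
  g_symm : ∀ X Y, g X Y = g Y X
  g_addLeft : ∀ X Y Z, g (X + Y) Z = g X Z + g Y Z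
  g_smulLeft : ∀ (f : F) (X Y : V), g (f • X) Y = f * g X Y
  g_nondeg : ∀ X, (∀ Y, g X Y = 0) → X = 0
  phi_add : ∀ α (X Y : V), phi α (X + Y) = phi α X + phi α Y
  phi_smul : ∀ α (f : F) (X : V), phi α (f • X) = f • phi α X
  eta_eq : ∀ α X, eta α X = g X (xi α)
  acm_sq : ∀ α X, phi α (phi α X) = -X + eta α X • xi α
  eta_xi : ∀ α, eta α (xi α) = 1
  compat : ∀ α X Y, g (phi α X) (phi α Y) = g X Y - eta α X * eta α Y
  quat_phi : ∀ a b c, Cyclic a b c → ∀ X, phi c X = phi a (phi b X) - eta b X • xi a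
  quat_phi' : ∀ a b c, Cyclic a b c → ∀ X, phi c X = -(phi b (phi a X)) + eta a X • xi b
  quat_xi : ∀ a b c, Cyclic a b c → xi c = phi a (xi b)
  quat_xi' : ∀ a b c, Cyclic a b c → xi c = -(phi b (xi a))
  quat_eta : ∀ a b c, Cyclic a b c → ∀ X, eta c X = eta a (phi b X)
  quat_eta' : ∀ a b c, Cyclic a b c → ∀ X, eta c X = -(eta b (phi a X))
  frame : Fin (4 * n + 3) → V
  frame_orth : ∀ i j, g (frame i) (frame j) = if i = j then 1 else 0
  frame_span : ∀ X : V, X = ∑ i, g X (frame i) • frame i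

section acm

variable (F V : Type) [CommRing F] [Algebra ℝ F] [AddCommGroup V] [Module F V]
  [SmoothSetting F V] [ACM3 F V]

/-- The integer `n` (the manifold has dimension `4n+3`). -/
def dimn : ℕ := ACM3.n F V

/-- The Riemannian metric. -/
def gm (X Y : V) : F := ACM3.g X Y

/-- The structure tensors `φ_α`. -/
def ph (α : Fin 3) (X : V) : V := ACM3.phi F α X

/-- The Reeb vector fields `ξ_α`. -/
def rxi (α : Fin 3) : V := ACM3.xi F α

/-- The 1-forms `η_α`. -/
def et (α : Fin 3) (X : V) : F := ACM3.eta α X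

/-- The orthonormal frame. -/
def fr (i : Fin (4 * dimn F V + 3)) : V := ACM3.frame i

/-- The fundamental 2-form `Φ_α(X,Y) = g(X, φ_α Y)`. -/
def Phi (α : Fin 3) (X Y : V) : F := gm F V X (ph F V α Y)

/-- The Nijenhuis torsion `[φ_α, φ_α]` of `φ_α`. -/
def Nij (α : Fin 3) (X Y : V) : V :=
  ph F V α (ph F V α (lie F V X Y)) + lie F V (ph F V α X) (ph F V α Y)
    - ph F V α (lie F V (ph F V α X) Y) - ph F V α (lie F V X (ph F V α Y))

/-- The normality tensor `N⁽¹⁾_α = [φ_α, φ_α] + 2 dη_α ⊗ ξ_α`. -/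
def NOne (α : Fin 3) (X Y : V) : V :=
  Nij F V α X Y + ((2 : ℝ) • dOne F V (et F V α) X Y) • rxi F V α

/-- The structure `(φ_α, ξ_α, η_α)` is normal. -/
def IsNormal (α : Fin 3) : Prop := ∀ X Y, NOne F V α X Y = 0

/-- A 2-form is closed. -/
def IsClosedTwo (ω : V → V → F) : Prop := ∀ X Y Z, dTwo F V ω X Y Z = 0

/-- The structure `(φ_α, ξ_α, η_α, g)` is quasi-Sasakian: normal with closed
fundamental 2-form. -/
def IsQuasiSasakian (α : Fin 3) : Prop :=
  IsNormal F V α ∧ IsClosedTwo F V (Phi F V α)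

/-- `M` is 3-cosymplectic: each structure is normal with `dη_α = 0` and `dΦ_α = 0`. -/
def ThreeCosymplectic : Prop :=
  ∀ α, IsNormal F V α ∧ (∀ X Y, dOne F V (et F V α) X Y = 0) ∧
    IsClosedTwo F V (Phi F V α)

/-- `M` is 3-α-Sasakian with constant `a ≠ 0`: each structure is normal (an
`α`-Sasakian structure) and `dη_δ = a Φ_δ`. -/
def Is3AlphaSasakianWith (a : ℝ) : Prop :=
  a ≠ 0 ∧ (∀ δ, IsNormal F V δ) ∧
    ∀ (δ : Fin 3) (X Y : V), dOne F V (et F V δ) X Y = algebraMap ℝ F a * Phi F V δ X Y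

/-- A vector field is horizontal: it lies in `H = ∩_α ker η_α`. -/
def Horiz (X : V) : Prop := ∀ α, et F V α X = 0

/-- A vector field is vertical: it lies in `V = ⟨ξ₁, ξ₂, ξ₃⟩`. -/
def InVert (X : V) : Prop :=
  ∃ p q r : F, X = p • rxi F V 0 + q • rxi F V 1 + r • rxi F V 2

/-- The distribution `E^{4m} = {X ∈ H : i_X dη_α = 0}`. -/
def InE4m (X : V) : Prop :=
  Horiz F V X ∧ ∀ (α : Fin 3) (Y : V), dOne F V (et F V α) X Y = 0

/-- The distribution `E^{4l}`: the orthogonal complement of `E^{4m}` in `H`. -/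
def InE4l (X : V) : Prop :=
  Horiz F V X ∧ ∀ Y, InE4m F V Y → gm F V X Y = 0

/-- The distribution `E^{4l+3} = E^{4l} ⊕ V`. -/
def InE4l3 (X : V) : Prop :=
  ∃ Y Z, InE4l F V Y ∧ InVert F V Z ∧ X = Y + Z

/-- The distribution `E^{4m+3} = E^{4m} ⊕ V`. -/
def InE4m3 (X : V) : Prop :=
  ∃ Y Z, InE4m F V Y ∧ InVert F V Z ∧ X = Y + Z

/-- The horizontal component `X_H = X - ∑_α η_α(X) ξ_α` of a vector field. -/
def horComp (X : V) : V := X - ∑ α : Fin 3, et F V α X • rxi F V α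

/-- A vector field is basic with respect to the foliation defined by `E^{4m}`. -/
def BasicE4m (X : V) : Prop :=
  InE4l3 F V X ∧ ∀ W, InE4m F V W → InE4m F V (lie F V W X)

/-- A vector field is basic with respect to the foliation defined by `E^{4l+3}`. -/
def BasicE4l3 (X : V) : Prop :=
  InE4m F V X ∧ ∀ W, InE4l3 F V W → InE4l3 F V (lie F V W X)

end acm

/-- A 3-quasi-Sasakian structure: each of the three almost contact metric
structures is quasi-Sasakian.  We also record, as part of the structure, the
standard structural facts established for such manifolds in the literature
(Cappelletti Montano–De Nicola–Dileo): the Reeb commutation relations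
`[ξ_α, ξ_β] = c ξ_γ`, the splitting `H = E^{4l} ⊕ E^{4m}` (constancy of the
rank), the `φ_α`-invariance of both distributions, and the tensors `ψ_α`
(equal to `φ_α` on `E^{4l+3}` and vanishing on `E^{4m}` when the rank is
`4l+3`, i.e. `c ≠ 0`; equal to `φ_α` on `E^{4l}` and vanishing on `E^{4m+3}`
when the rank is `4l+1`, i.e. `c = 0`). -/
class ThreeQS (F V : Type) [CommRing F] [Algebra ℝ F] [AddCommGroup V] [Module F V]
    [SmoothSetting F V] [ACM3 F V] where
  qs : ∀ α, IsQuasiSasakian F V α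
  c : ℝ
  reeb_bracket : ∀ a b c', Cyclic a b c' →
    lie F V (rxi F V a) (rxi F V b) = algebraMap ℝ F c • rxi F V c'
  horiz_split : ∀ X, Horiz F V X → ∃ Y Z, InE4l F V Y ∧ InE4m F V Z ∧ X = Y + Z
  phi_E4l : ∀ α X, InE4l F V X → InE4l F V (ph F V α X)
  phi_E4m : ∀ α X, InE4m F V X → InE4m F V (ph F V α X)
  psi : Fin 3 → V → V
  psi_add : ∀ α (X Y : V), psi α (X + Y) = psi α X + psi α Y
  psi_smul : ∀ α (f : F) (X : V), psi α (f • X) = f • psi α X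
  psi_E4l : ∀ α X, InE4l F V X → psi α X = ph F V α X
  psi_E4m : ∀ α X, InE4m F V X → psi α X = 0
  psi_vert_of_ne : c ≠ 0 → ∀ α β, psi α (rxi F V β) = ph F V α (rxi F V β)
  psi_vert_of_eq : c = 0 → ∀ α β, psi α (rxi F V β) = 0

section tqs

variable (F V : Type) [CommRing F] [Algebra ℝ F] [AddCommGroup V] [Module F V]
  [SmoothSetting F V] [ACM3 F V] [ThreeQS F V]

/-- The constant `c` with `[ξ_α, ξ_β] = c ξ_γ`. -/
def cc : ℝ := ThreeQS.c F V

/-- The tensors `ψ_α`. -/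
def psiT (α : Fin 3) (X : V) : V := ThreeQS.psi F α X

/-- The tensors `θ_α = φ_α - ψ_α`. -/
def thetaT (α : Fin 3) (X : V) : V := ph F V α X - psiT F V α X

/-- The 2-forms `Θ_α(X,Y) = g(X, θ_α Y)`. -/
def ThetaForm (α : Fin 3) (X Y : V) : F := gm F V X (thetaT F V α Y)

end tqs

/-- The 3-quasi-Sasakian manifold has rank `4l+3`: the constant `c` is nonzero
and the orthonormal frame is adapted to the splitting
`TM = E^{4l} ⊕ E^{4m} ⊕ ⟨ξ₁,ξ₂,ξ₃⟩` with `dim E^{4l} = 4l` (hence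
`dim E^{4m} = 4m`, `m = n - l`, and the rank of the `η_α` is `4l+3`). -/
class HasRank (F V : Type) [CommRing F] [Algebra ℝ F] [AddCommGroup V] [Module F V]
    [SmoothSetting F V] [ACM3 F V] [ThreeQS F V] (l : ℕ) : Prop where
  c_ne : cc F V ≠ 0
  l_le : l ≤ dimn F V
  frame_E4l : ∀ i : Fin (4 * dimn F V + 3), i.val < 4 * l → InE4l F V (fr F V i)
  frame_E4m : ∀ i : Fin (4 * dimn F V + 3), 4 * l ≤ i.val → i.val < 4 * dimn F V →
    InE4m F V (fr F V i)
  frame_xi : ∀ (i : Fin (4 * dimn F V + 3)) (a : Fin 3),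
    i.val = 4 * dimn F V + a.val → fr F V i = rxi F V a

/-- The Levi-Civita connection of `g`: the unique torsion-free metric connection. -/
class LeviCivita (F V : Type) [CommRing F] [Algebra ℝ F] [AddCommGroup V] [Module F V]
    [SmoothSetting F V] [ACM3 F V] where
  nabla : V → V → V
  nabla_addLeft : ∀ X Y Z : V, nabla (X + Y) Z = nabla X Z + nabla Y Z
  nabla_smulLeft : ∀ (f : F) (X Y : V), nabla (f • X) Y = f • nabla X Y
  nabla_addRight : ∀ X Y Z : V, nabla X (Y + Z) = nabla X Y + nabla X Z
  nabla_leibniz : ∀ (X : V) (f : F) (Y : V),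
    nabla X (f • Y) = der F V X f • Y + f • nabla X Y
  nabla_metric : ∀ X Y Z : V,
    der F V X (gm F V Y Z) = gm F V (nabla X Y) Z + gm F V Y (nabla X Z)
  nabla_torsionFree : ∀ X Y : V, nabla X Y - nabla Y X = lie F V X Y

section curv

variable (F V : Type) [CommRing F] [Algebra ℝ F] [AddCommGroup V] [Module F V]
  [SmoothSetting F V] [ACM3 F V] [LeviCivita F V]

/-- The Levi-Civita covariant derivative `∇_X Y`. -/
def nab (X Y : V) : V := LeviCivita.nabla F X Y

/-- The Riemannian curvature `R(X,Y)Z = ∇_X ∇_Y Z - ∇_Y ∇_X Z - ∇_{[X,Y]} Z`. -/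
def Rcurv (X Y Z : V) : V :=
  nab F V X (nab F V Y Z) - nab F V Y (nab F V X Z) - nab F V (lie F V X Y) Z

/-- The Ricci tensor `Ric(X,Y) = ∑_i g(R(e_i, X)Y, e_i)`. -/
def Ric (X Y : V) : F :=
  ∑ i, gm F V (Rcurv F V (fr F V i) X Y) (fr F V i)

/-- The scalar curvature. -/
def Scal : F := ∑ i, Ric F V (fr F V i) (fr F V i)

/-- `M` is Einstein: `Ric = a g` for a constant `a`. -/
def Einstein : Prop :=
  ∃ a : ℝ, ∀ X Y, Ric F V X Y = algebraMap ℝ F a * gm F V X Y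

/-- `M` is η-Einstein: `Ric = a g + b ∑_α η_α ⊗ η_α` for constants `a, b`. -/
def EtaEinstein : Prop :=
  ∃ a b : ℝ, ∀ X Y, Ric F V X Y
    = algebraMap ℝ F a * gm F V X Y
      + algebraMap ℝ F b * ∑ α : Fin 3, et F V α X * et F V α Y

end curv

/-- A (Koszul) linear connection on vector fields. -/
def IsConnection (F V : Type) [CommRing F] [Algebra ℝ F] [AddCommGroup V] [Module F V]
    [SmoothSetting F V] (D : V → V → V) : Prop :=
  (∀ X Y Z : V, D (X + Y) Z = D X Z + D Y Z) ∧
  (∀ (f : F) (X Y : V), D (f • X) Y = f • D X Y) ∧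
  (∀ X Y Z : V, D X (Y + Z) = D X Y + D X Z) ∧
  (∀ (X : V) (f : F) (Y : V), D X (f • Y) = der F V X f • Y + f • D X Y)

end QS3

namespace QS3

section algebra

variable {F V : Type} [CommRing F] [Algebra ℝ F] [AddCommGroup V] [Module F V]

lemma eq_zero_of_add_self {x : F} (h : x + x = 0) : x = 0 := by
  have h2 : (2 : ℝ)⁻¹ • (x + x) = x := by
    rw [← two_smul ℝ x, smul_smul]; norm_num
  rw [← h2, h, smul_zero]

lemma Cyclic.rotate {a b c : Fin 3} (h : Cyclic a b c) : Cyclic b c a := by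
  unfold Cyclic at *; simp only [Prod.mk.injEq] at *; tauto

lemma exists_cyclic (a : Fin 3) : ∃ b c, Cyclic a b c := by
  fin_cases a
  · exact ⟨1, 2, Or.inl rfl⟩
  · exact ⟨2, 0, Or.inr (Or.inl rfl)⟩
  · exact ⟨0, 1, Or.inr (Or.inr rfl)⟩

end algebra

section contact

variable (F V : Type) [CommRing F] [Algebra ℝ F] [AddCommGroup V] [Module F V]
  [SmoothSetting F V] [ACM3 F V]

/-- The metric as a bilinear map. -/
def metric : V →ₗ[F] V →ₗ[F] F :=
  LinearMap.mk₂ F (gm F V) ACM3.g_addLeft ACM3.g_smulLeft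
    (fun X Y Z => by
      simp only [gm]; rw [ACM3.g_symm X, ACM3.g_addLeft, ACM3.g_symm Y, ACM3.g_symm Z])
    (fun f X Y => by
      simp only [gm, smul_eq_mul]; rw [ACM3.g_symm X, ACM3.g_smulLeft, ACM3.g_symm Y])

/-- The structure tensor `φ_α` as a linear map. -/
def structMap (α : Fin 3) : V →ₗ[F] V where
  toFun := ph F V α
  map_add' := ACM3.phi_add α
  map_smul' := ACM3.phi_smul α

local notation "𝐠" => metric F V
local notation "𝐉" => structMap F V
local notation "ξ" => rxi F V

variable {F V}

lemma gm_eq (X Y : V) : gm F V X Y = 𝐠 X Y := rfl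

lemma ph_eq (α : Fin 3) (X : V) : ph F V α X = 𝐉 α X := rfl

lemma et_eq (α : Fin 3) (X : V) : et F V α X = 𝐠 X (ξ α) := ACM3.eta_eq α X

variable (F) in
lemma metric_symm (X Y : V) : 𝐠 X Y = 𝐠 Y X := ACM3.g_symm X Y

lemma eq_zero_of_metric {X : V} (h : ∀ Z, 𝐠 X Z = 0) : X = 0 := ACM3.g_nondeg X h

lemma metric_ext {X Y : V} (h : ∀ Z, 𝐠 X Z = 𝐠 Y Z) : X = Y :=
  sub_eq_zero.1 <| eq_zero_of_metric fun Z => by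
    rw [map_sub (metric F V), LinearMap.sub_apply, h, sub_self]

lemma metric_add_left (X Y Z : V) : 𝐠 (X + Y) Z = 𝐠 X Z + 𝐠 Y Z := by
  rw [map_add (metric F V), LinearMap.add_apply]

lemma metric_neg_left (X Y : V) : 𝐠 (-X) Y = -𝐠 X Y := by
  rw [map_neg (metric F V), LinearMap.neg_apply]

lemma metric_smul_left (f : F) (X Y : V) : 𝐠 (f • X) Y = f * 𝐠 X Y := by
  rw [map_smul (metric F V), LinearMap.smul_apply, smul_eq_mul]

lemma structMap_sq (α : Fin 3) (X : V) : 𝐉 α (𝐉 α X) = -X + 𝐠 X (ξ α) • ξ α := by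
  rw [← et_eq (F := F)]; exact ACM3.acm_sq α X

@[simp] lemma metric_xi_self (α : Fin 3) : 𝐠 (ξ α) (ξ α) = 1 := by
  rw [← et_eq]; exact ACM3.eta_xi α

lemma metric_structMap_structMap (α : Fin 3) (X Y : V) :
    𝐠 (𝐉 α X) (𝐉 α Y) = 𝐠 X Y - 𝐠 X (ξ α) * 𝐠 Y (ξ α) := by
  rw [← et_eq, ← et_eq]; exact ACM3.compat α X Y

section cyclic

variable {a b c : Fin 3}

lemma structMap_comp (h : Cyclic a b c) (X : V) :
    𝐉 a (𝐉 b X) = 𝐉 c X + 𝐠 X (ξ b) • ξ a := by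
  have h1 : 𝐉 c X = 𝐉 a (𝐉 b X) - et F V b X • ξ a := ACM3.quat_phi a b c h X
  rw [h1, et_eq, sub_add_cancel]

lemma structMap_comp' (h : Cyclic a b c) (X : V) :
    𝐉 b (𝐉 a X) = -𝐉 c X + 𝐠 X (ξ a) • ξ b := by
  have h1 : 𝐉 c X = -𝐉 b (𝐉 a X) + et F V a X • ξ b := ACM3.quat_phi' a b c h X
  rw [h1, et_eq]; abel

lemma structMap_xi_next (h : Cyclic a b c) : 𝐉 a (ξ b) = ξ c :=
  (ACM3.quat_xi a b c h).symm

lemma structMap_xi_prev (h : Cyclic a b c) : 𝐉 b (ξ a) = -ξ c := by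
  have h1 : ξ c = -𝐉 b (ξ a) := ACM3.quat_xi' a b c h
  rw [h1, neg_neg]

lemma metric_xi_next (h : Cyclic a b c) : 𝐠 (ξ a) (ξ b) = 0 := by
  have h1 : et F V b (ξ a) = et F V c (𝐉 a (ξ a)) := ACM3.quat_eta c a b h.rotate.rotate _
  have h2 : et F V a (ξ b) = -et F V c (𝐉 b (ξ b)) := ACM3.quat_eta' b c a h.rotate _
  have h3 : et F V a (ξ b) = et F V b (𝐉 c (ξ b)) := ACM3.quat_eta b c a h.rotate _
  rw [structMap_xi_prev h.rotate] at h3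
  simp only [et_eq, map_neg, LinearMap.neg_apply] at h3
  rw [metric_symm F] at h3
  exact eq_zero_of_add_self (by linear_combination h3)

lemma metric_xi_prev (h : Cyclic a b c) : 𝐠 (ξ b) (ξ a) = 0 := by
  rw [metric_symm F, metric_xi_next h]

lemma structMap_xi_self_eq (h : Cyclic a b c) : 𝐉 a (ξ a) = 𝐉 b (ξ b) := by
  have h1 := structMap_comp (F := F) h.rotate (ξ a)
  rw [structMap_xi_next h.rotate.rotate, metric_xi_prev h.rotate.rotate] at h1
  simpa using h1.symm

end cyclic

@[simp] lemma structMap_xi_self (a : Fin 3) : 𝐉 a (ξ a) = 0 := by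
  have key : ∀ d, 𝐉 d (ξ d) = 𝐠 (𝐉 d (ξ d)) (ξ d) • ξ d := fun d => metric_ext fun Y => by
    have h := metric_structMap_structMap (F := F) d (ξ d) (𝐉 d Y)
    rw [structMap_sq, metric_xi_self, metric_symm F (ξ d)] at h
    simp only [map_add, map_neg, map_smul, smul_eq_mul] at h
    rw [map_smul (metric F V), LinearMap.smul_apply, smul_eq_mul]
    linear_combination -h + 𝐠 (𝐉 d (ξ d)) (ξ d) * metric_symm F Y (ξ d)
  obtain ⟨b, c, h⟩ := exists_cyclic a
  have hb := key b
  rw [← structMap_xi_self_eq h] at hb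
  rw [key a, hb]
  simp [metric_xi_prev h]

@[simp] lemma metric_structMap_xi (a : Fin 3) (X : V) : 𝐠 (𝐉 a X) (ξ a) = 0 := by
  have h := congrArg (𝐉 a) (structMap_sq (F := F) a X)
  rw [structMap_sq, map_add, map_neg, map_smul, structMap_xi_self, smul_zero, add_right_inj] at h
  simpa using congrArg (fun Z => 𝐠 Z (ξ a)) h

@[simp] lemma metric_xi_structMap (a : Fin 3) (X : V) : 𝐠 (ξ a) (𝐉 a X) = 0 := by
  rw [metric_symm F, metric_structMap_xi]

lemma metric_structMap_left (a : Fin 3) (X Y : V) : 𝐠 (𝐉 a X) Y = -𝐠 X (𝐉 a Y) := by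
  have h := metric_structMap_structMap (F := F) a X (𝐉 a Y)
  rw [structMap_sq] at h
  simp only [map_add, map_neg, map_smul, metric_structMap_xi, smul_eq_mul] at h
  linear_combination -h

end contact

section derivation

variable (F V : Type) [CommRing F] [Algebra ℝ F] [AddCommGroup V] [Module F V]
  [SmoothSetting F V]

lemma der_add (X : V) (f h : F) : der F V X (f + h) = der F V X f + der F V X h :=
  SmoothSetting.act_add X f h

lemma der_algebraMap (X : V) (r : ℝ) : der F V X (algebraMap ℝ F r) = 0 :=
  SmoothSetting.act_const X r

lemma der_zero (X : V) : der F V X 0 = 0 := by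
  simpa using der_algebraMap F V X 0

lemma der_one (X : V) : der F V X 1 = 0 := by
  simpa using der_algebraMap F V X 1

lemma der_neg (X : V) (f : F) : der F V X (-f) = -der F V X f := by
  rw [eq_neg_iff_add_eq_zero, ← der_add, neg_add_cancel, der_zero]

lemma der_lie (X Y : V) (f : F) :
    der F V (lie F V X Y) f = der F V X (der F V Y f) - der F V Y (der F V X f) :=
  SmoothSetting.bracket_act X Y f

end derivation

section connection

variable (F V : Type) [CommRing F] [Algebra ℝ F] [AddCommGroup V] [Module F V]
  [SmoothSetting F V] [ACM3 F V] [LeviCivita F V]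

local notation "𝐠" => metric F V
local notation "𝐉" => structMap F V
local notation "ξ" => rxi F V
local notation "𝐃" => nab F V

lemma nab_add_left (X Y Z : V) : 𝐃 (X + Y) Z = 𝐃 X Z + 𝐃 Y Z :=
  LeviCivita.nabla_addLeft X Y Z

lemma nab_smul_left (f : F) (X Y : V) : 𝐃 (f • X) Y = f • 𝐃 X Y :=
  LeviCivita.nabla_smulLeft f X Y

lemma nab_neg_left (X Y : V) : 𝐃 (-X) Y = -𝐃 X Y := by
  simpa using nab_smul_left F V (-1) X Y

lemma nab_sub_left (X Y Z : V) : 𝐃 (X - Y) Z = 𝐃 X Z - 𝐃 Y Z := by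
  rw [sub_eq_add_neg, nab_add_left, nab_neg_left, sub_eq_add_neg]

lemma nab_add (X Y Z : V) : 𝐃 X (Y + Z) = 𝐃 X Y + 𝐃 X Z :=
  LeviCivita.nabla_addRight X Y Z

lemma nab_smul (X : V) (f : F) (Y : V) : 𝐃 X (f • Y) = der F V X f • Y + f • 𝐃 X Y :=
  LeviCivita.nabla_leibniz X f Y

lemma nab_zero (X : V) : 𝐃 X 0 = 0 := by
  simpa using nab_add F V X 0 0

lemma nab_neg (X Y : V) : 𝐃 X (-Y) = -𝐃 X Y := by
  rw [eq_neg_iff_add_eq_zero, ← nab_add, neg_add_cancel, nab_zero]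

lemma nab_sub (X Y Z : V) : 𝐃 X (Y - Z) = 𝐃 X Y - 𝐃 X Z := by
  rw [sub_eq_add_neg, nab_add, nab_neg, sub_eq_add_neg]

lemma der_metric (X Y Z : V) : der F V X (𝐠 Y Z) = 𝐠 (𝐃 X Y) Z + 𝐠 Y (𝐃 X Z) :=
  LeviCivita.nabla_metric X Y Z

lemma lie_eq (X Y : V) : lie F V X Y = 𝐃 X Y - 𝐃 Y X :=
  (LeviCivita.nabla_torsionFree X Y).symm

/-- The endomorphism `X ↦ ∇_X ξ_α`. -/
def reebDeriv (α : Fin 3) : V →ₗ[F] V where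
  toFun X := 𝐃 X (ξ α)
  map_add' X Y := nab_add_left F V X Y _
  map_smul' f X := nab_smul_left F V f X _

local notation "𝐓" => reebDeriv F V

/-- The covariant derivative `(X, Y) ↦ (∇_X φ) Y` of an endomorphism `φ`. -/
def endDeriv (A : V →ₗ[F] V) : V →ₗ[F] V →ₗ[F] V :=
  LinearMap.mk₂ F (fun X Y => 𝐃 X (A Y) - A (𝐃 X Y))
    (fun X Y Z => by simp only [nab_add_left, map_add]; abel)
    (fun f X Y => by simp only [nab_smul_left, map_smul, smul_sub])
    (fun X Y Z => by simp only [nab_add, map_add]; abel)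
    (fun f X Y => by
      simp only [nab_smul, map_add, map_smul, smul_sub]; abel)

variable {F V}

lemma nab_xi (X : V) (α : Fin 3) : 𝐃 X (ξ α) = 𝐓 α X := rfl

lemma nab_apply (A : V →ₗ[F] V) (X Y : V) :
    𝐃 X (A Y) = endDeriv F V A X Y + A (𝐃 X Y) := by
  simp [endDeriv]

local notation "𝐩" α => endDeriv F V (structMap F V α)

@[simp] lemma metric_reebDeriv_xi (α : Fin 3) (X : V) : 𝐠 (𝐓 α X) (ξ α) = 0 := by
  have h := der_metric F V X (ξ α) (ξ α)
  rw [metric_xi_self, der_one, nab_xi, metric_symm F (ξ α)] at h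
  exact eq_zero_of_add_self h.symm

@[simp] lemma metric_xi_reebDeriv (α : Fin 3) (X : V) : 𝐠 (ξ α) (𝐓 α X) = 0 := by
  rw [metric_symm F, metric_reebDeriv_xi]

lemma metric_endDeriv_structMap (α : Fin 3) (X Y Z : V) :
    𝐠 ((𝐩 α) X Y) Z = -𝐠 Y ((𝐩 α) X Z) := by
  have h1 := der_metric F V X (𝐉 α Y) Z
  have h2 := der_metric F V X Y (𝐉 α Z)
  rw [metric_structMap_left, der_neg, h2, nab_apply, nab_apply] at h1
  simp only [map_add, LinearMap.add_apply, metric_structMap_left] at h1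
  linear_combination -h1

lemma endDeriv_structMap_apply_structMap (α : Fin 3) (X Y : V) :
    (𝐩 α) X (𝐉 α Y) = -𝐉 α ((𝐩 α) X Y) + 𝐠 (𝐓 α X) Y • ξ α + 𝐠 Y (ξ α) • 𝐓 α X := by
  have h := congrArg (𝐃 X) (structMap_sq (F := F) α Y)
  rw [nab_apply, nab_apply, nab_add, nab_neg, nab_smul, der_metric, nab_xi, map_add,
    structMap_sq, metric_symm F Y (𝐓 α X)] at h
  rw [← sub_eq_zero] at h ⊢
  rw [← h]
  module

lemma endDeriv_structMap_xi (α : Fin 3) (X : V) : (𝐩 α) X (ξ α) = -𝐉 α (𝐓 α X) := by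
  have h := nab_apply (𝐉 α) X (ξ α)
  rw [structMap_xi_self, nab_zero, nab_xi] at h
  exact eq_neg_of_add_eq_zero_left h.symm

variable [ThreeQS F V]

lemma endDeriv_structMap_cyclic (α : Fin 3) (X Y Z : V) :
    𝐠 ((𝐩 α) X Y) Z + 𝐠 ((𝐩 α) Y Z) X + 𝐠 ((𝐩 α) Z X) Y = 0 := by
  have h := (ThreeQS.qs (F := F) (V := V) α).2 X Y Z
  unfold dTwo at h
  rw [smul_eq_zero_iff_right (by norm_num)] at h
  simp only [Phi, gm_eq, ph_eq, lie_eq, der_metric, nab_apply, map_add, map_sub,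
    LinearMap.sub_apply] at h
  have hs : ∀ A B : V, 𝐠 A (𝐉 α B) = -𝐠 B (𝐉 α A) := fun A B => by
    rw [metric_symm F, metric_structMap_left]
  have hp : ∀ A B C : V, 𝐠 A ((𝐩 α) B C) = -𝐠 ((𝐩 α) B A) C := fun A B C => by
    rw [metric_endDeriv_structMap, neg_neg]
  rw [hp, hp, hp] at h
  linear_combination -h + hs (𝐃 Y X) Z + hs (𝐃 Z Y) X + hs (𝐃 X Z) Y

lemma normality_eq (α : Fin 3) (X Y : V) :
    (𝐩 α) (𝐉 α X) Y - (𝐩 α) (𝐉 α Y) X + 𝐉 α ((𝐩 α) Y X) - 𝐉 α ((𝐩 α) X Y)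
      + (𝐠 (𝐓 α X) Y - 𝐠 (𝐓 α Y) X) • ξ α = 0 := by
  have h := (ThreeQS.qs (F := F) (V := V) α).1 X Y
  simp only [NOne, Nij, dOne, smul_smul, ph_eq, et_eq, lie_eq, nab_apply, map_add, map_sub,
    LinearMap.sub_apply, der_metric, nab_xi] at h
  rw [mul_inv_cancel₀ two_ne_zero, one_smul, metric_symm F Y, metric_symm F X (𝐓 α Y)] at h
  rw [← h]
  module

@[simp] lemma reebDeriv_xi_self (α : Fin 3) : 𝐓 α (ξ α) = 0 := eq_zero_of_metric fun X => by
  have h := congrArg (fun Z => 𝐠 Z (ξ α)) (normality_eq (F := F) α X (ξ α))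
  simp only [map_add, map_sub, map_neg, map_smul, map_zero, LinearMap.add_apply,
      LinearMap.sub_apply, LinearMap.neg_apply, LinearMap.zero_apply,
      LinearMap.smul_apply, smul_eq_mul, neg_zero, endDeriv_structMap_xi, structMap_xi_self,
      metric_structMap_xi, metric_xi_self, metric_reebDeriv_xi] at h
  linear_combination -h

/-- The Reeb vector fields are Killing. -/
lemma metric_reebDeriv_left (α : Fin 3) (X Y : V) : 𝐠 (𝐓 α X) Y = -𝐠 X (𝐓 α Y) := by
  have key : ∀ X Z : V, 𝐠 (𝐓 α (𝐉 α X)) (𝐉 α Z) + 𝐠 (𝐓 α (𝐉 α Z)) (𝐉 α X) = 0 := fun X Z => by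
    have h1 := congrArg (fun U => 𝐠 U Z) (normality_eq (F := F) α X (ξ α))
    have h2 := endDeriv_structMap_cyclic (F := F) α (ξ α) X (𝐉 α Z)
    have h3 := metric_endDeriv_structMap (F := F) α X (𝐉 α Z) (ξ α)
    simp only [map_add, map_sub, map_neg, map_smul, map_zero, LinearMap.add_apply,
      LinearMap.sub_apply, LinearMap.neg_apply, LinearMap.zero_apply,
      LinearMap.smul_apply, smul_eq_mul, endDeriv_structMap_xi, structMap_xi_self, metric_structMap_left,
      metric_reebDeriv_xi, reebDeriv_xi_self, structMap_sq] at h1 h2 h3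
    linear_combination h1 + h2 - h3 - metric_symm F Z (𝐓 α X)
  have h := key (𝐉 α X) (𝐉 α Y)
  simp only [map_add, map_neg, map_smul, map_zero, LinearMap.add_apply,
      LinearMap.neg_apply, LinearMap.zero_apply,
      smul_eq_mul, smul_zero, neg_zero, structMap_sq, reebDeriv_xi_self, metric_reebDeriv_xi] at h
  linear_combination h + metric_symm F X (𝐓 α Y)

lemma reebDeriv_structMap (α : Fin 3) (X : V) : 𝐓 α (𝐉 α X) = 𝐉 α (𝐓 α X) :=
  metric_ext (F := F) fun Y => by
    have h := congrArg (fun Z => 𝐠 Z (ξ α)) (normality_eq (F := F) α (𝐉 α X) Y)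
    simp only [map_add, map_sub, map_neg, map_smul, map_zero, LinearMap.add_apply,
      LinearMap.sub_apply, LinearMap.neg_apply, LinearMap.zero_apply,
      LinearMap.smul_apply, smul_eq_mul, neg_zero, structMap_sq, metric_endDeriv_structMap, endDeriv_structMap_xi,
      metric_structMap_xi, metric_xi_self, metric_structMap_structMap, metric_reebDeriv_xi, reebDeriv_xi_self] at h
    have h1 := metric_reebDeriv_left (F := F) α X (𝐉 α Y)
    have h2 := metric_reebDeriv_left (F := F) α Y (𝐉 α X)
    have h3 := metric_structMap_left (F := F) α (𝐓 α X) Y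
    have h4 := metric_symm F Y (𝐓 α (𝐉 α X))
    have h5 := metric_symm F Y (𝐉 α (𝐓 α X))
    refine sub_eq_zero.1 (eq_zero_of_add_self (F := F) ?_)
    linear_combination h + h1 + h2 - h3 - h4 + h5

lemma metric_structMap_reebDeriv (α : Fin 3) (X Y : V) :
    𝐠 (𝐉 α (𝐓 α X)) Y = 𝐠 X (𝐉 α (𝐓 α Y)) := by
  rw [metric_structMap_left, metric_reebDeriv_left, reebDeriv_structMap, neg_neg]

/-- The covariant derivative of the structure tensor of a quasi-Sasakian structure. -/
lemma endDeriv_structMap (α : Fin 3) (X Y : V) :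
    (𝐩 α) X Y = 𝐠 (𝐉 α (𝐓 α X)) Y • ξ α - 𝐠 Y (ξ α) • 𝐉 α (𝐓 α X) :=
  metric_ext (F := F) fun Z => by
    have hξ : ∀ A B : V, 𝐠 ((𝐩 α) A B) (ξ α) = 𝐠 (𝐉 α (𝐓 α A)) B := fun A B => by
      rw [metric_endDeriv_structMap, endDeriv_structMap_xi, map_neg, neg_neg, metric_symm F]
    have hJ : ∀ A B C : V, 𝐠 ((𝐩 α) A (𝐉 α B)) C = 𝐠 ((𝐩 α) A B) (𝐉 α C)
        + 𝐠 (𝐓 α A) B * 𝐠 (ξ α) C + 𝐠 B (ξ α) * 𝐠 (𝐓 α A) C := fun A B C => by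
      rw [endDeriv_structMap_apply_structMap]
      simp only [metric_add_left, metric_neg_left, metric_smul_left, metric_structMap_left, neg_neg]
    have e1 := endDeriv_structMap_cyclic (F := F) α X Y Z
    have e2 := endDeriv_structMap_cyclic (F := F) α X (𝐉 α Y) (𝐉 α Z)
    have e3 := congrArg (fun U => 𝐠 U (𝐉 α X)) (normality_eq (F := F) α Y Z)
    have e4 := metric_endDeriv_structMap (F := F) α Z Y X
    have e5 := metric_endDeriv_structMap (F := F) α (𝐉 α Z) X (𝐉 α Y)
    have s1 := metric_symm F Y ((𝐩 α) Z X)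
    have s2 := metric_symm F X ((𝐩 α) (𝐉 α Z) (𝐉 α Y))
    have b1 := metric_structMap_reebDeriv (F := F) α X Y
    have b2 := metric_structMap_reebDeriv (F := F) α X Z
    have s3 := metric_symm F X (𝐉 α (𝐓 α Y))
    have s4 := metric_symm F X (𝐉 α (𝐓 α Z))
    have s6 := metric_structMap_left (F := F) α (𝐓 α X) Z
    have s7 := metric_symm F (ξ α) X
    have s8 := metric_symm F (ξ α) Z
    simp only [map_add, map_sub, map_neg, map_smul, map_zero, LinearMap.add_apply,
      LinearMap.sub_apply, LinearMap.zero_apply,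
      LinearMap.smul_apply, smul_eq_mul, hJ, hξ, structMap_sq, reebDeriv_structMap, metric_structMap_structMap,
      metric_xi_structMap] at e2 e3 e4 e5 s2 ⊢
    refine sub_eq_zero.1 (eq_zero_of_add_self (F := F) ?_)
    linear_combination e1 - e2 + e3 + e5 - s2 - e4 + s1 - 2 * 𝐠 (𝐉 α (𝐓 α X)) Y * s8
      - 𝐠 Z (ξ α) * (b1 + s3) + 𝐠 Y (ξ α) * s6 + 𝐠 Y (ξ α) * (b2 + s4)
      + (𝐠 (𝐉 α (𝐓 α Y)) Z - 𝐠 (𝐉 α (𝐓 α Z)) Y) * s7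

end connection

section reeb

variable {F V : Type} [CommRing F] [Algebra ℝ F] [AddCommGroup V] [Module F V]
  [SmoothSetting F V] [ACM3 F V] [LeviCivita F V] [ThreeQS F V]

local notation "𝐠" => metric F V
local notation "𝐉" => structMap F V
local notation "ξ" => rxi F V
local notation "𝐓" => reebDeriv F V
local notation "𝐩" α => endDeriv F V (structMap F V α)
local notation "𝐚" => algebraMap ℝ F (cc F V / 2)

section cyclic

variable {a b c : Fin 3}

lemma reebDeriv_eq_next (h : Cyclic a b c) (X : V) :
    𝐓 c X = 𝐠 (𝐉 a (𝐓 a X)) (ξ b) • ξ a + 𝐉 a (𝐓 b X) := by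
  rw [← nab_xi, ← structMap_xi_next h, nab_apply, endDeriv_structMap, metric_xi_prev h, nab_xi]
  module

lemma reebDeriv_eq_prev (h : Cyclic a b c) (X : V) :
    𝐓 c X = -𝐠 (𝐉 b (𝐓 b X)) (ξ a) • ξ b - 𝐉 b (𝐓 a X) := by
  have e : ξ c = -𝐉 b (ξ a) := by rw [structMap_xi_prev h, neg_neg]
  rw [← nab_xi, e, nab_neg, nab_apply, endDeriv_structMap, metric_xi_next h, nab_xi]
  module

lemma reebDeriv_xi_next_eq (h : Cyclic a b c) : 𝐓 a (ξ b) = 𝐠 (𝐓 a (ξ b)) (ξ c) • ξ c := by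
  have e := congrArg (𝐉 c) (reebDeriv_eq_next (F := F) h.rotate.rotate (ξ b))
  rw [reebDeriv_xi_self, map_zero, map_add, map_smul, structMap_xi_self, structMap_sq] at e
  rw [← sub_eq_zero, ← neg_eq_zero, e]
  module

lemma reebDeriv_xi_prev_eq (h : Cyclic a b c) : 𝐓 b (ξ a) = 𝐠 (𝐓 b (ξ a)) (ξ c) • ξ c := by
  have e := congrArg (𝐉 c) (reebDeriv_eq_prev (F := F) h.rotate (ξ a))
  rw [reebDeriv_xi_self, map_zero, map_sub, map_smul, structMap_xi_self, structMap_sq] at e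
  rw [← sub_eq_zero, e]
  module

lemma metric_reebDeriv_xi_next (h : Cyclic a b c) : 𝐠 (𝐓 a (ξ b)) (ξ c) = -𝐚 := by
  have key : ∀ {a b c : Fin 3}, Cyclic a b c →
      𝐠 (𝐓 a (ξ b)) (ξ c) + 𝐠 (𝐓 b (ξ c)) (ξ a) = -algebraMap ℝ F (cc F V) := by
    intro a b c h
    have e := congrArg (fun Z => 𝐠 Z (ξ c)) (ThreeQS.reeb_bracket (F := F) a b c h)
    have e' : ThreeQS.c F V = cc F V := rfl
    simp only [lie_eq, nab_xi, map_sub, LinearMap.sub_apply, metric_smul_left, metric_xi_self,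
      e'] at e
    have e2 := metric_reebDeriv_left (F := F) b (ξ a) (ξ c)
    have e3 := metric_symm F (ξ a) (𝐓 b (ξ c))
    linear_combination -e + e2 - e3
  have hh : algebraMap ℝ F (cc F V) = 𝐚 + 𝐚 := by rw [← map_add, add_halves]
  refine eq_neg_of_add_eq_zero_left (eq_zero_of_add_self (F := F) ?_)
  linear_combination key h - key h.rotate + key h.rotate.rotate - hh

lemma reebDeriv_xi_next (h : Cyclic a b c) : 𝐓 a (ξ b) = -(𝐚 • ξ c) := by
  rw [reebDeriv_xi_next_eq h, metric_reebDeriv_xi_next h, neg_smul]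

lemma reebDeriv_xi_prev (h : Cyclic a b c) : 𝐓 b (ξ a) = 𝐚 • ξ c := by
  rw [reebDeriv_xi_prev_eq h, metric_reebDeriv_left, metric_symm F,
    metric_reebDeriv_xi_next h.rotate, neg_neg]

/-- `φ_α ∇ξ_α + (c/2) η_α ⊗ ξ_α` does not depend on `α`. -/
lemma structMap_reebDeriv_cyclic (h : Cyclic a b c) (X : V) :
    𝐉 c (𝐓 c X) + (𝐚 * 𝐠 X (ξ c)) • ξ c = 𝐉 a (𝐓 a X) + (𝐚 * 𝐠 X (ξ a)) • ξ a := by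
  have e1 : 𝐠 (𝐉 b (𝐓 b X)) (ξ a) = 𝐚 * 𝐠 X (ξ a) := by
    rw [metric_structMap_reebDeriv, reebDeriv_xi_prev h, map_smul, structMap_xi_next h.rotate,
      map_smul, smul_eq_mul]
  have e2 : 𝐠 (𝐓 a X) (ξ b) = 𝐚 * 𝐠 X (ξ c) := by
    rw [metric_reebDeriv_left, reebDeriv_xi_next h, map_neg, map_smul, neg_neg, smul_eq_mul]
  rw [reebDeriv_eq_prev h X, map_sub, map_smul, structMap_comp' h.rotate, e1, e2,
    structMap_xi_prev h.rotate]
  module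

end cyclic

variable (F V) in
/-- The orthogonal projection `2/c φ_α ∇ξ_α + η_α ⊗ ξ_α` onto `E^{4l+3}`. -/
def rankProj : V →ₗ[F] V :=
  algebraMap ℝ F (2 / cc F V) • (𝐉 0 ∘ₗ 𝐓 0) + ((𝐠).flip (ξ 0)).smulRight (ξ 0)

local notation "𝐏" => rankProj F V

lemma half_mul_inv (hc : cc F V ≠ 0) : 𝐚 * algebraMap ℝ F (2 / cc F V) = 1 := by
  rw [← map_mul, div_mul_div_cancel₀ two_ne_zero, div_self hc, map_one]

lemma half_smul_inj (hc : cc F V ≠ 0) {X : V} (h : 𝐚 • X = 0) : X = 0 := by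
  rw [← one_smul F X, ← half_mul_inv hc, mul_comm, mul_smul, h, smul_zero]

lemma half_mul_inj (hc : cc F V ≠ 0) {x : F} (h : 𝐚 * x = 0) : x = 0 := by
  rw [← one_mul x, ← half_mul_inv hc, mul_comm, ← mul_assoc, mul_comm x, h, zero_mul]

lemma structMap_reebDeriv_eq (hc : cc F V ≠ 0) (α : Fin 3) (X : V) :
    𝐉 α (𝐓 α X) = 𝐚 • 𝐏 X - (𝐚 * 𝐠 X (ξ α)) • ξ α := by
  have key : 𝐉 α (𝐓 α X) + (𝐚 * 𝐠 X (ξ α)) • ξ α = 𝐉 0 (𝐓 0 X) + (𝐚 * 𝐠 X (ξ 0)) • ξ 0 := by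
    fin_cases α
    · rfl
    · exact (structMap_reebDeriv_cyclic (Or.inr (Or.inl rfl)) X).symm
    · exact structMap_reebDeriv_cyclic (Or.inl rfl) X
  rw [eq_sub_iff_add_eq, key]
  simp only [rankProj, LinearMap.add_apply, LinearMap.smul_apply, LinearMap.comp_apply,
    LinearMap.smulRight_apply, LinearMap.flip_apply, smul_add, smul_smul, half_mul_inv hc, one_smul]

lemma reebDeriv_eq (hc : cc F V ≠ 0) (α : Fin 3) (X : V) : 𝐓 α X = -(𝐚 • 𝐉 α (𝐏 X)) := by
  have h := congrArg (𝐉 α) (structMap_reebDeriv_eq hc α X)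
  rw [structMap_sq, metric_reebDeriv_xi, map_sub, map_smul, map_smul, structMap_xi_self] at h
  rw [← neg_eq_iff_eq_neg, ← sub_eq_zero]
  rw [← sub_eq_zero] at h
  rw [← h]
  module

lemma rankProj_xi (hc : cc F V ≠ 0) (α : Fin 3) : 𝐏 (ξ α) = ξ α := by
  have h := structMap_reebDeriv_eq hc α (ξ α)
  rw [reebDeriv_xi_self, map_zero, metric_xi_self, mul_one, ← smul_sub] at h
  exact sub_eq_zero.1 (half_smul_inj hc h.symm)

lemma metric_rankProj (hc : cc F V ≠ 0) (X Y : V) : 𝐠 (𝐏 X) Y = 𝐠 X (𝐏 Y) := by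
  have h := metric_structMap_reebDeriv (F := F) 0 X Y
  rw [structMap_reebDeriv_eq hc, structMap_reebDeriv_eq hc] at h
  simp only [map_sub, LinearMap.sub_apply, LinearMap.smul_apply, map_smul, smul_eq_mul] at h
  refine sub_eq_zero.1 (half_mul_inj hc (?_ : 𝐚 * _ = 0))
  linear_combination h + 𝐚 * 𝐠 X (ξ 0) * metric_symm F (ξ 0) Y

lemma rankProj_structMap (hc : cc F V ≠ 0) (α : Fin 3) (X : V) : 𝐏 (𝐉 α X) = 𝐉 α (𝐏 X) := by
  have h := congrArg (𝐉 α) (reebDeriv_structMap (F := F) α X)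
  rw [structMap_reebDeriv_eq hc, structMap_reebDeriv_eq hc, metric_structMap_xi, map_sub,
    map_smul, map_smul, structMap_xi_self] at h
  refine sub_eq_zero.1 (half_smul_inj hc ?_)
  rw [← sub_eq_zero] at h
  rw [← h]
  module

lemma endDeriv_structMap_eq (hc : cc F V ≠ 0) (α : Fin 3) (X Y : V) :
    (𝐩 α) X Y = 𝐚 • (𝐠 (𝐏 X) Y • ξ α - 𝐠 Y (ξ α) • 𝐏 X) := by
  rw [endDeriv_structMap, structMap_reebDeriv_eq hc]
  simp only [map_sub, LinearMap.sub_apply, metric_smul_left]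
  rw [metric_symm F (ξ α) Y]
  module

end reeb

section curvature

variable {F V : Type} [CommRing F] [Algebra ℝ F] [AddCommGroup V] [Module F V]
  [SmoothSetting F V] [ACM3 F V] [LeviCivita F V]

local notation "𝐠" => metric F V
local notation "ξ" => rxi F V
local notation "𝐓" => reebDeriv F V
local notation "𝐑" => Rcurv F V

lemma Rcurv_antisymm (X Y Z : V) : 𝐑 X Y Z = -𝐑 Y X Z := by
  simp only [Rcurv, lie_eq, nab_sub_left]
  abel

lemma Rcurv_bianchi (X Y Z : V) : 𝐑 X Y Z + 𝐑 Y Z X + 𝐑 Z X Y = 0 := by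
  have h : lie F V X (lie F V Y Z) + lie F V Y (lie F V Z X) + lie F V Z (lie F V X Y) = 0 :=
    SmoothSetting.jacobi X Y Z
  rw [← h]
  simp only [Rcurv, lie_eq, nab_sub_left, nab_sub]
  abel

lemma metric_Rcurv (X Y Z U : V) : 𝐠 (𝐑 X Y Z) U = -𝐠 Z (𝐑 X Y U) := by
  have h := der_lie F V X Y (𝐠 Z U)
  simp only [der_metric, der_add] at h
  simp only [Rcurv, map_sub, LinearMap.sub_apply]
  linear_combination -h

lemma metric_endDeriv_symm {A : V →ₗ[F] V} (hA : ∀ X Y, 𝐠 (A X) Y = 𝐠 X (A Y)) (X Y Z : V) :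
    𝐠 (endDeriv F V A X Y) Z = 𝐠 Y (endDeriv F V A X Z) := by
  have h1 := der_metric F V X (A Y) Z
  have h2 := der_metric F V X Y (A Z)
  rw [hA, h2, nab_apply, nab_apply] at h1
  simp only [map_add, LinearMap.add_apply, hA] at h1
  linear_combination -h1

lemma metric_endDeriv_reebDeriv [ThreeQS F V] (α : Fin 3) (X Y Z : V) :
    𝐠 (endDeriv F V (𝐓 α) X Y) Z = -𝐠 Y (endDeriv F V (𝐓 α) X Z) := by
  have h1 := der_metric F V X (𝐓 α Y) Z
  have h2 := der_metric F V X Y (𝐓 α Z)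
  rw [metric_reebDeriv_left, der_neg, h2, nab_apply, nab_apply] at h1
  simp only [map_add, LinearMap.add_apply, metric_reebDeriv_left] at h1
  linear_combination -h1

lemma Rcurv_xi (α : Fin 3) (X Y : V) :
    𝐑 X Y (ξ α) = endDeriv F V (𝐓 α) X Y - endDeriv F V (𝐓 α) Y X := by
  simp only [Rcurv, nab_xi, nab_apply, lie_eq, map_sub]
  abel

lemma endDeriv_reebDeriv_cyclic [ThreeQS F V] (α : Fin 3) (X Y Z : V) :
    𝐠 (endDeriv F V (𝐓 α) X Y) Z + 𝐠 (endDeriv F V (𝐓 α) Y Z) X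
      + 𝐠 (endDeriv F V (𝐓 α) Z X) Y = 0 := by
  have h := congrArg (𝐠 (ξ α)) (Rcurv_bianchi (F := F) X Y Z)
  have hR : ∀ X Y Z : V, 𝐠 (ξ α) (𝐑 X Y Z) = -𝐠 (𝐑 X Y (ξ α)) Z := fun X Y Z => by
    rw [metric_Rcurv, neg_neg]
  have hs : ∀ X Y Z : V, 𝐠 (endDeriv F V (𝐓 α) X Y) Z = -𝐠 (endDeriv F V (𝐓 α) X Z) Y :=
    fun X Y Z => by rw [metric_endDeriv_reebDeriv, metric_symm F]
  simp only [map_add, map_zero, hR, Rcurv_xi, map_sub, LinearMap.sub_apply] at h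
  refine eq_zero_of_add_self (F := F) ?_
  linear_combination -h + hs X Y Z + hs Y Z X + hs Z X Y

end curvature

section projection

variable {F V : Type} [CommRing F] [Algebra ℝ F] [AddCommGroup V] [Module F V]
  [SmoothSetting F V] [ACM3 F V] [LeviCivita F V] [ThreeQS F V]

local notation "𝐠" => metric F V
local notation "𝐉" => structMap F V
local notation "ξ" => rxi F V
local notation "𝐓" => reebDeriv F V
local notation "𝐩" α => endDeriv F V (structMap F V α)
local notation "𝐚" => algebraMap ℝ F (cc F V / 2)
local notation "𝐏" => rankProj F V
local notation "𝐝" => endDeriv F V (rankProj F V)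

lemma eq_zero_of_structMap {α : Fin 3} {X : V} (h : 𝐉 α X = 0) (hX : 𝐠 X (ξ α) = 0) : X = 0 := by
  have e := structMap_sq (F := F) α X
  rw [h, map_zero, hX, zero_smul, add_zero] at e
  exact neg_eq_zero.1 e.symm

lemma endDeriv_reebDeriv (hc : cc F V ≠ 0) (α : Fin 3) (X Y : V) :
    endDeriv F V (𝐓 α) X Y = -(𝐚 • ((𝐩 α) X (𝐏 Y) + 𝐉 α (𝐝 X Y))) := by
  have h := nab_apply (𝐓 α) X Y
  have h0 : der F V X 𝐚 = 0 := der_algebraMap F V X _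
  rw [reebDeriv_eq hc, nab_neg, nab_smul, h0, nab_apply, nab_apply, reebDeriv_eq hc,
    map_add] at h
  rw [← sub_eq_iff_eq_add] at h
  rw [← h]
  module

lemma endDeriv_rankProj_xi (hc : cc F V ≠ 0) (α : Fin 3) (X : V) :
    𝐝 X (ξ α) = 𝐓 α X - 𝐏 (𝐓 α X) := by
  have h := nab_apply 𝐏 X (ξ α)
  rw [rankProj_xi hc, nab_xi] at h
  exact (sub_eq_of_eq_add h).symm

lemma endDeriv_rankProj_reeb (hc : cc F V ≠ 0) (α : Fin 3) (Y : V) : 𝐝 (ξ α) Y = 0 := by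
  have hS := metric_endDeriv_symm (F := F) (A := 𝐏) (metric_rankProj hc)
  have hξ : ∀ Z : V, endDeriv F V (𝐓 α) Z (ξ α) = -𝐓 α (𝐓 α Z) := fun Z => by
    have h := nab_apply (𝐓 α) Z (ξ α)
    rw [reebDeriv_xi_self, nab_zero, nab_xi] at h
    exact eq_neg_of_add_eq_zero_left h.symm
  have h0 : endDeriv F V (𝐓 α) (ξ α) Y = 0 := eq_zero_of_metric (F := F) fun Z => by
    have e := endDeriv_reebDeriv_cyclic (F := F) α (ξ α) Y Z
    rw [metric_endDeriv_reebDeriv α Y, hξ, hξ] at e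
    have e1 := metric_reebDeriv_left (F := F) α (𝐓 α Y) Z
    have e2 := metric_reebDeriv_left (F := F) α (𝐓 α Z) Y
    have e3 := metric_symm F (𝐓 α (𝐓 α Y)) Z
    have e4 := metric_symm F (𝐓 α Y) (𝐓 α Z)
    simp only [map_neg, LinearMap.neg_apply] at e
    linear_combination e + e2 - e1 + e3 + e4
  rw [endDeriv_reebDeriv hc, endDeriv_structMap_eq hc, rankProj_xi hc, ← metric_rankProj hc,
    rankProj_xi hc, metric_rankProj hc, rankProj_xi hc, metric_symm F (ξ α) Y, sub_self,
    smul_zero, zero_add, neg_eq_zero] at h0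
  refine eq_zero_of_structMap (half_smul_inj hc h0) ?_
  rw [hS, endDeriv_rankProj_xi hc, reebDeriv_xi_self, map_zero, sub_zero, map_zero]

lemma rankProj_idem (hc : cc F V ≠ 0) (X : V) : 𝐏 (𝐏 X) = 𝐏 X := by
  have h012 : Cyclic 0 1 2 := Or.inl rfl
  have hξ : ∀ Z : V, endDeriv F V (𝐓 1) Z (ξ 0) = 𝐚 • 𝐓 2 Z - 𝐓 1 (𝐓 0 Z) := fun Z => by
    have h := nab_apply (𝐓 1) Z (ξ 0)
    rw [reebDeriv_xi_prev h012, nab_smul, der_algebraMap, nab_xi, nab_xi] at h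
    rw [← sub_eq_iff_eq_add] at h
    rw [← h]
    module
  have hP : ∀ (Z : V) α, 𝐠 (𝐏 Z) (ξ α) = 𝐠 Z (ξ α) := fun Z α => by
    rw [metric_rankProj hc, rankProj_xi hc]
  have hJ : ∀ Y Z : V, 𝐠 Z (𝐉 2 (𝐏 Y)) = -𝐠 (𝐉 2 (𝐏 Z)) Y := fun Y Z => by
    rw [← rankProj_structMap hc, ← metric_rankProj hc, metric_structMap_left, neg_neg]
  have hJ2 : ∀ Y Z : V, 𝐠 Z (𝐉 2 (𝐏 (𝐏 Y))) = -𝐠 (𝐉 2 (𝐏 (𝐏 Z))) Y := fun Y Z => by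
    rw [hJ, ← metric_rankProj hc, rankProj_structMap hc]
  have key : ∀ Y Z : V, 𝐠 (𝐉 2 (𝐏 (𝐏 Z) - 𝐏 Z)) Y = 0 := fun Y Z => by
    have e := endDeriv_reebDeriv_cyclic (F := F) 1 (ξ 0) Y Z
    rw [metric_endDeriv_reebDeriv 1 Y, hξ, hξ, endDeriv_reebDeriv hc,
      endDeriv_rankProj_reeb hc, endDeriv_structMap_eq hc, rankProj_xi hc] at e
    simp only [reebDeriv_eq hc, map_neg, map_smul, rankProj_structMap hc, structMap_comp' h012,
      map_add, map_sub, map_zero, LinearMap.add_apply, LinearMap.sub_apply, LinearMap.neg_apply,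
      LinearMap.smul_apply, LinearMap.zero_apply, smul_eq_mul, hJ2, hJ, metric_symm F (ξ 0),
      metric_symm F (ξ 1), hP] at e ⊢
    refine half_mul_inj hc (half_mul_inj hc (eq_zero_of_add_self (F := F) ?_))
    linear_combination e
  refine sub_eq_zero.1 (eq_zero_of_structMap (α := 2)
    (eq_zero_of_metric (F := F) fun Y => key Y X) ?_)
  rw [map_sub, LinearMap.sub_apply, metric_rankProj hc (𝐏 X), rankProj_xi hc, sub_self]

end projection

section parallel

variable {F V : Type} [CommRing F] [Algebra ℝ F] [AddCommGroup V] [Module F V]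
  [SmoothSetting F V] [ACM3 F V] [LeviCivita F V] [ThreeQS F V]

local notation "𝐠" => metric F V
local notation "𝐉" => structMap F V
local notation "ξ" => rxi F V
local notation "𝐏" => rankProj F V
local notation "𝐝" => endDeriv F V (rankProj F V)

lemma metric_endDeriv_rankProj (hc : cc F V ≠ 0) (X Y Z : V) :
    𝐠 (𝐝 X Y) Z = 𝐠 Y (𝐝 X Z) :=
  metric_endDeriv_symm (F := F) (A := 𝐏) (metric_rankProj hc) X Y Z

lemma rankProj_endDeriv (hc : cc F V ≠ 0) (X Y : V) :
    𝐏 (𝐝 X Y) = 𝐝 X Y - 𝐝 X (𝐏 Y) := by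
  have h := nab_apply 𝐏 X (𝐏 Y)
  rw [rankProj_idem hc, nab_apply 𝐏 X Y, map_add, rankProj_idem hc] at h
  rw [← sub_eq_zero] at h ⊢
  rw [← neg_eq_zero, ← h]
  abel

lemma rankProj_endDeriv_rankProj (hc : cc F V ≠ 0) (X Y : V) : 𝐏 (𝐝 X (𝐏 Y)) = 0 := by
  rw [rankProj_endDeriv hc, rankProj_idem hc, sub_self]

lemma endDeriv_rankProj_xi_eq_zero (hc : cc F V ≠ 0) (α : Fin 3) (X : V) : 𝐝 X (ξ α) = 0 := by
  rw [endDeriv_rankProj_xi hc, reebDeriv_eq hc, map_neg, map_smul, rankProj_structMap hc,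
    rankProj_idem hc, sub_self]

lemma metric_endDeriv_rankProj_xi (hc : cc F V ≠ 0) (α : Fin 3) (X Y : V) :
    𝐠 (𝐝 X Y) (ξ α) = 0 := by
  rw [metric_endDeriv_rankProj hc, endDeriv_rankProj_xi_eq_zero hc, map_zero]

lemma endDeriv_rankProj_structMap (hc : cc F V ≠ 0) (α : Fin 3) (X Y : V) :
    𝐝 X (𝐉 α Y) = 𝐉 α (𝐝 X Y) := by
  have h1 := nab_apply 𝐏 X (𝐉 α Y)
  have h2 := nab_apply (𝐉 α) X (𝐏 Y)
  rw [rankProj_structMap hc, h2, nab_apply, nab_apply, endDeriv_structMap_eq hc,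
    endDeriv_structMap_eq hc, ← metric_rankProj hc, rankProj_idem hc, metric_rankProj hc Y,
    rankProj_xi hc] at h1
  simp only [map_add, map_sub, map_smul, rankProj_structMap hc, rankProj_xi hc,
    rankProj_idem hc] at h1
  rw [← sub_eq_zero] at h1 ⊢
  rw [← neg_eq_zero, ← h1]
  module

lemma endDeriv_rankProj_cyclic (hc : cc F V ≠ 0) (α : Fin 3) (X Y Z : V) :
    𝐠 (𝐉 α (𝐝 X Y)) Z + 𝐠 (𝐉 α (𝐝 Y Z)) X + 𝐠 (𝐉 α (𝐝 Z X)) Y = 0 := by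
  have h := endDeriv_reebDeriv_cyclic (F := F) α X Y Z
  have hP : ∀ Z : V, 𝐠 (𝐏 Z) (ξ α) = 𝐠 Z (ξ α) := fun Z => by
    rw [metric_rankProj hc, rankProj_xi hc]
  have hPP : ∀ Y Z : V, 𝐠 (𝐏 Y) (𝐏 Z) = 𝐠 (𝐏 Y) Z := fun Y Z => by
    rw [← metric_rankProj hc, rankProj_idem hc]
  have hs : ∀ Y Z : V, 𝐠 (𝐏 Y) Z = 𝐠 (𝐏 Z) Y := fun Y Z => by
    rw [metric_rankProj hc, metric_symm F]
  simp only [endDeriv_reebDeriv hc, endDeriv_structMap_eq hc, map_neg, map_add, map_sub, map_smul,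
    LinearMap.add_apply, LinearMap.sub_apply, LinearMap.neg_apply, LinearMap.smul_apply,
    smul_eq_mul, hP, hPP, metric_symm F (ξ α)] at h
  rw [hs Y X, hs Z X, hs Z Y] at h
  refine half_mul_inj hc ?_
  linear_combination -h

lemma endDeriv_rankProj_proj_proj (hc : cc F V ≠ 0) {A : V →ₗ[F] V}
    (hA : ∀ X Y, 𝐠 (A X) Y = 𝐠 X (A Y)) (hAJ : ∀ α X, A (𝐉 α X) = 𝐉 α (A X))
    (hAd : ∀ X Y, A (𝐝 X (A Y)) = 0) (X Y : V) : 𝐝 (A X) (A Y) = 0 := by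
  have hs : ∀ X Y, 𝐝 (A X) (A Y) = 𝐝 (A Y) (A X) := fun X Y => by
    refine sub_eq_zero.1 (eq_zero_of_structMap (F := F) (α := 0)
      (eq_zero_of_metric (F := F) fun Z => ?_) ?_)
    · have e := endDeriv_rankProj_cyclic (F := F) hc 0 (Z - A Z) (A X) (A Y)
      have e0 : ∀ U X Y, 𝐠 (𝐉 0 (𝐝 U (A X))) (A Y) = 0 := fun U X Y => by
        rw [← hA, hAJ, hAd, map_zero, map_zero, LinearMap.zero_apply]
      have e1 : 𝐠 (𝐉 0 (𝐝 (A Y) (Z - A Z))) (A X) = -𝐠 (𝐉 0 (𝐝 (A Y) (A X))) (Z - A Z) := by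
        rw [metric_structMap_left, metric_endDeriv_rankProj hc, endDeriv_rankProj_structMap hc,
          metric_symm F]
      rw [e0, e1, map_sub, map_sub, e0, e0] at e
      rw [map_sub, map_sub, LinearMap.sub_apply]
      linear_combination e
    · rw [map_sub, LinearMap.sub_apply, metric_endDeriv_rankProj_xi hc,
        metric_endDeriv_rankProj_xi hc, sub_zero]
  have hr : ∀ α X Y, 𝐝 (A X) (A (𝐉 α Y)) = 𝐉 α (𝐝 (A X) (A Y)) := fun α X Y => by
    rw [hAJ, endDeriv_rankProj_structMap hc]
  have hl : ∀ α X Y, 𝐝 (A (𝐉 α X)) (A Y) = 𝐉 α (𝐝 (A X) (A Y)) := fun α X Y => by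
    rw [hs, hr, hs]
  have h012 : Cyclic 0 1 2 := Or.inl rfl
  have e : 𝐉 0 (𝐉 1 (𝐝 (A X) (A Y))) = 𝐉 1 (𝐉 0 (𝐝 (A X) (A Y))) := by
    rw [← hr 1, ← hl 0, ← hl 0, hr 1]
  rw [structMap_comp h012, structMap_comp' h012, metric_endDeriv_rankProj_xi hc,
    metric_endDeriv_rankProj_xi hc, zero_smul, zero_smul, add_zero, add_zero] at e
  refine eq_zero_of_structMap (α := 2) (eq_zero_of_metric (F := F) fun Z => eq_zero_of_add_self ?_)
    (metric_endDeriv_rankProj_xi hc _ _ _)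
  have e' := congrArg (fun U => 𝐠 U Z) e
  simp only [map_neg, LinearMap.neg_apply] at e'
  linear_combination e'

/-- The projection onto `E^{4l+3}` is parallel. -/
lemma endDeriv_rankProj_eq_zero (hc : cc F V ≠ 0) (X Y : V) : 𝐝 X Y = 0 := by
  have hP := endDeriv_rankProj_proj_proj (A := 𝐏) hc (metric_rankProj hc) (rankProj_structMap hc)
    (rankProj_endDeriv_rankProj hc)
  have hQ := endDeriv_rankProj_proj_proj (A := LinearMap.id - 𝐏) hc
    (fun X Y => by simp [metric_rankProj hc]) (fun α X => by simp [rankProj_structMap hc])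
    (fun X Y => by
      simp [rankProj_endDeriv hc, rankProj_idem hc])
  simp only [LinearMap.sub_apply, LinearMap.id_apply] at hQ
  have hPd := rankProj_endDeriv hc
  have hXY : ∀ X Y, 𝐝 (𝐏 X) Y = 0 := fun X Y => eq_zero_of_metric (F := F) fun Z => by
    rw [← sub_zero (𝐝 (𝐏 X) Y), ← hP X Y, ← hPd, metric_rankProj hc, metric_endDeriv_rankProj hc,
      hP, map_zero]
  have hXY' : ∀ X Y, 𝐝 (X - 𝐏 X) Y = 0 := fun X Y => eq_zero_of_metric (F := F) fun Z => by
    have h := hQ X Z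
    have h' := hQ X Y
    rw [map_sub, sub_eq_zero] at h
    rw [map_sub] at h'
    rw [metric_endDeriv_rankProj hc, h, ← metric_endDeriv_rankProj hc, ← metric_rankProj hc, hPd,
      h', map_zero, LinearMap.zero_apply]
  rw [← sub_add_cancel X (𝐏 X), map_add, LinearMap.add_apply, hXY, hXY', add_zero]

end parallel

section residual

variable {F V : Type} [CommRing F] [Algebra ℝ F] [AddCommGroup V] [Module F V]
  [SmoothSetting F V] [ACM3 F V] [LeviCivita F V] [ThreeQS F V]

local notation "𝐠" => metric F V
local notation "𝐉" => structMap F V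
local notation "ξ" => rxi F V
local notation "𝐃" => nab F V
local notation "𝐚" => algebraMap ℝ F (cc F V / 2)
local notation "𝐏" => rankProj F V
local notation "𝐑" => Rcurv F V

lemma nab_rankProj (hc : cc F V ≠ 0) (X Y : V) : 𝐃 X (𝐏 Y) = 𝐏 (𝐃 X Y) := by
  rw [nab_apply, endDeriv_rankProj_eq_zero hc, zero_add]

lemma Rcurv_add (X Y Z U : V) : 𝐑 X Y (Z + U) = 𝐑 X Y Z + 𝐑 X Y U := by
  simp only [Rcurv, nab_add]
  abel

lemma Rcurv_smul (X Y : V) (f : F) (Z : V) : 𝐑 X Y (f • Z) = f • 𝐑 X Y Z := by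
  simp only [Rcurv, nab_add, nab_smul, der_lie]
  module

variable (F V) in
/-- The difference between the curvature tensor and the curvature tensor of the leaves
of `E^{4l+3}`, which have constant curvature `c²/4`. -/
def residCurv (X Z : V) : V →ₗ[F] V where
  toFun Y := 𝐑 X Z Y - (𝐚 * 𝐚) • (𝐠 (𝐏 Z) Y • 𝐏 X - 𝐠 (𝐏 X) Y • 𝐏 Z)
  map_add' Y U := by
    rw [Rcurv_add, map_add, map_add]
    module
  map_smul' f Y := by
    rw [Rcurv_smul, map_smul, map_smul, RingHom.id_apply, smul_eq_mul, smul_eq_mul]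
    module

local notation "𝐖" => residCurv F V

lemma residCurv_apply (X Z Y : V) :
    𝐖 X Z Y = 𝐑 X Z Y - (𝐚 * 𝐚) • (𝐠 (𝐏 Z) Y • 𝐏 X - 𝐠 (𝐏 X) Y • 𝐏 Z) :=
  rfl

lemma residCurv_antisymm (X Y Z : V) : 𝐖 X Y Z = -𝐖 Y X Z := by
  rw [residCurv_apply, residCurv_apply, Rcurv_antisymm]
  module

lemma residCurv_bianchi (hc : cc F V ≠ 0) (X Y Z : V) : 𝐖 X Y Z + 𝐖 Y Z X + 𝐖 Z X Y = 0 := by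
  have hs : ∀ Y Z : V, 𝐠 (𝐏 Y) Z = 𝐠 (𝐏 Z) Y := fun Y Z => by
    rw [metric_rankProj hc, metric_symm F]
  rw [← Rcurv_bianchi (F := F) X Y Z]
  simp only [residCurv_apply]
  rw [hs Y X, hs Z X, hs Z Y]
  module

lemma metric_residCurv (X Y Z U : V) : 𝐠 (𝐖 X Y Z) U = -𝐠 Z (𝐖 X Y U) := by
  simp only [residCurv_apply, map_sub, LinearMap.sub_apply, LinearMap.smul_apply, map_smul, smul_eq_mul,
    metric_Rcurv X Y Z U]
  rw [metric_symm F Z (𝐏 X), metric_symm F Z (𝐏 Y)]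
  ring

lemma residCurv_structMap (hc : cc F V ≠ 0) (α : Fin 3) (X Z Y : V) :
    𝐖 X Z (𝐉 α Y) = 𝐉 α (𝐖 X Z Y) := by
  have hs : ∀ X : V, 𝐠 (𝐏 X) (𝐉 α Y) = -𝐠 Y (𝐉 α (𝐏 X)) := fun X => by
    rw [metric_symm F Y, metric_structMap_left, neg_neg]
  have h0 : ∀ X, der F V X 𝐚 = 0 := fun X => der_algebraMap F V X _
  rw [← sub_eq_zero]
  simp only [residCurv_apply, Rcurv, nab_apply (𝐉 α), endDeriv_structMap_eq hc, nab_add, nab_sub,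
    nab_smul, h0, der_metric, nab_xi, reebDeriv_eq hc, nab_rankProj hc, map_sub, map_neg,
    map_smul, LinearMap.sub_apply, lie_eq, hs]
  module

lemma residCurv_xi (hc : cc F V ≠ 0) (α : Fin 3) (X Z : V) : 𝐖 X Z (ξ α) = 0 := by
  refine eq_zero_of_structMap (F := F) (α := α) ?_ (eq_zero_of_add_self (F := F) ?_)
  · rw [← residCurv_structMap hc, structMap_xi_self, map_zero]
  · have h := metric_residCurv (F := F) X Z (ξ α) (ξ α)
    rw [metric_symm F (ξ α)] at h
    linear_combination h

lemma metric_residCurv_xi (hc : cc F V ≠ 0) (α : Fin 3) (X Y Z : V) :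
    𝐠 (𝐖 X Y Z) (ξ α) = 0 := by
  rw [metric_residCurv, residCurv_xi hc, map_zero, neg_zero]

end residual

section ricci

variable {F V : Type} [CommRing F] [Algebra ℝ F] [AddCommGroup V] [Module F V]
  [SmoothSetting F V] [ACM3 F V] [LeviCivita F V] [ThreeQS F V]

local notation "𝐠" => metric F V
local notation "𝐉" => structMap F V
local notation "ξ" => rxi F V
local notation "𝐓" => reebDeriv F V
local notation "𝐚" => algebraMap ℝ F (cc F V / 2)
local notation "𝐏" => rankProj F V
local notation "𝐖" => residCurv F V
local notation "𝐞" => fr F V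

variable (F) in
lemma frame_expand (X : V) : X = ∑ i, 𝐠 X (𝐞 i) • 𝐞 i :=
  ACM3.frame_span X

variable (F) in
lemma metric_eq_sum (X Y : V) : 𝐠 X Y = ∑ i, 𝐠 X (𝐞 i) * 𝐠 Y (𝐞 i) := by
  conv_lhs => rw [frame_expand F X]
  simp only [map_sum, LinearMap.sum_apply, metric_smul_left, metric_symm F Y]

/-- The trace of a product of endomorphisms does not depend on their order. -/
lemma sum_metric_comp_comm (M N : V →ₗ[F] V) :
    ∑ i, 𝐠 (M (N (𝐞 i))) (𝐞 i) = ∑ i, 𝐠 (N (M (𝐞 i))) (𝐞 i) := by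
  have key : ∀ M N : V →ₗ[F] V, ∑ i, 𝐠 (M (N (𝐞 i))) (𝐞 i)
      = ∑ i, ∑ j, 𝐠 (N (𝐞 i)) (𝐞 j) * 𝐠 (M (𝐞 j)) (𝐞 i) := fun M N => by
    refine Finset.sum_congr rfl fun i _ => ?_
    conv_lhs => rw [frame_expand F (N (𝐞 i))]
    simp only [map_sum, LinearMap.sum_apply, map_smul, LinearMap.smul_apply, smul_eq_mul]
  rw [key, key, Finset.sum_comm]
  exact Finset.sum_congr rfl fun i _ => Finset.sum_congr rfl fun j _ => mul_comm _ _

lemma sum_metric_structMap_residCurv (hc : cc F V ≠ 0) (γ : Fin 3) (X Y : V) :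
    ∑ i, 𝐠 (𝐉 γ (𝐖 X Y (𝐞 i))) (𝐞 i) = 0 := by
  obtain ⟨α, β, h⟩ := exists_cyclic γ
  have h := h.rotate
  have e1 : ∀ Z, 𝐉 γ (𝐖 X Y Z) = 𝐉 α (𝐖 X Y (𝐉 β Z)) := fun Z => by
    rw [residCurv_structMap hc, structMap_comp h, metric_residCurv_xi hc, zero_smul, add_zero]
  have e2 : ∀ Z, 𝐖 X Y (𝐉 β (𝐉 α Z)) = -𝐉 γ (𝐖 X Y Z) := fun Z => by
    rw [residCurv_structMap hc, residCurv_structMap hc, structMap_comp' h,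
      metric_residCurv_xi hc, zero_smul, add_zero]
  have e := sum_metric_comp_comm (𝐉 α) (𝐖 X Y ∘ₗ 𝐉 β)
  simp only [LinearMap.comp_apply, ← e1, e2, map_neg, LinearMap.neg_apply,
    Finset.sum_neg_distrib] at e
  refine eq_zero_of_add_self (F := F) ?_
  linear_combination e

variable (F V) in
/-- The Ricci contraction of `residCurv`. -/
def residRic (X Y : V) : F := ∑ i, 𝐠 (𝐖 (𝐞 i) X Y) (𝐞 i)

local notation "𝐫" => residRic F V

lemma residRic_symm (hc : cc F V ≠ 0) (X Y : V) : 𝐫 X Y = 𝐫 Y X := by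
  have h : ∑ i, 𝐠 (𝐖 X Y (𝐞 i)) (𝐞 i) = 0 := Finset.sum_eq_zero fun i _ => by
    have h := metric_residCurv (F := F) X Y (𝐞 i) (𝐞 i)
    rw [metric_symm F (𝐞 i)] at h
    refine eq_zero_of_add_self (F := F) ?_
    linear_combination h
  rw [residRic, residRic, ← sub_eq_zero, ← Finset.sum_sub_distrib, ← neg_eq_zero, ← h,
    ← Finset.sum_neg_distrib]
  refine Finset.sum_congr rfl fun i _ => ?_
  have e := congrArg (fun U => 𝐠 U (𝐞 i)) (residCurv_bianchi hc X Y (𝐞 i))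
  rw [residCurv_antisymm Y] at e
  simp only [map_add, map_neg, map_zero, LinearMap.add_apply, LinearMap.neg_apply,
    LinearMap.zero_apply] at e
  linear_combination -e

lemma residRic_structMap_comm (hc : cc F V ≠ 0) (α : Fin 3) (X Y : V) :
    𝐫 X (𝐉 α Y) = 𝐫 Y (𝐉 α X) := by
  rw [← sub_eq_zero, ← neg_eq_zero, ← sum_metric_structMap_residCurv hc α X Y, residRic, residRic,
    ← Finset.sum_sub_distrib, ← Finset.sum_neg_distrib]
  refine Finset.sum_congr rfl fun i _ => ?_
  have e := congrArg (fun U => 𝐠 (𝐉 α U) (𝐞 i)) (residCurv_bianchi hc X Y (𝐞 i))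
  rw [residCurv_antisymm Y] at e
  simp only [map_add, map_neg, map_zero, LinearMap.add_apply, LinearMap.neg_apply,
    LinearMap.zero_apply] at e
  rw [residCurv_structMap hc, residCurv_structMap hc]
  linear_combination -e

lemma residRic_add (X Y Z : V) : 𝐫 X (Y + Z) = 𝐫 X Y + 𝐫 X Z := by
  simp only [residRic, map_add, LinearMap.add_apply, Finset.sum_add_distrib]

lemma residRic_neg (X Y : V) : 𝐫 X (-Y) = -𝐫 X Y := by
  simp only [residRic, map_neg, LinearMap.neg_apply, Finset.sum_neg_distrib]

lemma residRic_smul_xi (hc : cc F V ≠ 0) (X : V) (f : F) (α : Fin 3) : 𝐫 X (f • ξ α) = 0 := by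
  simp only [residRic, map_smul, residCurv_xi hc, smul_zero, map_zero, LinearMap.zero_apply,
    Finset.sum_const_zero]

lemma residRic_eq_zero (hc : cc F V ≠ 0) (X Y : V) : 𝐫 X Y = 0 := by
  have h012 : Cyclic 0 1 2 := Or.inl rfl
  have key : ∀ X Y : V, 𝐫 X (𝐉 2 Y) = 0 := fun X Y => by
    have e1 := residRic_structMap_comm hc 0 (𝐉 1 Y) X
    have e2 := residRic_structMap_comm hc 1 (𝐉 0 X) Y
    rw [residRic_symm hc, e2, structMap_comp h012, structMap_comp' h012, residRic_add,
      residRic_add, residRic_smul_xi hc, residRic_smul_xi hc, residRic_neg,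
      residRic_structMap_comm hc 2 Y X] at e1
    refine eq_zero_of_add_self (F := F) ?_
    linear_combination -e1
  have h := key X (𝐉 2 Y)
  rw [structMap_sq, residRic_add, residRic_smul_xi hc, residRic_neg, add_zero] at h
  exact neg_eq_zero.1 h

lemma Ric_eq (hc : cc F V ≠ 0) (X Y : V) :
    Ric F V X Y = 𝐚 * 𝐚 * (∑ i, 𝐠 (𝐏 (𝐞 i)) (𝐞 i) - 1) * 𝐠 (𝐏 X) Y := by
  have h := residRic_eq_zero hc X Y
  have h1 : ∑ i, 𝐠 (𝐏 (𝐞 i)) Y * 𝐠 (𝐏 X) (𝐞 i) = 𝐠 (𝐏 X) Y := by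
    rw [← rankProj_idem hc X, metric_rankProj hc (𝐏 X) Y, rankProj_idem hc, metric_eq_sum F (𝐏 X)]
    refine Finset.sum_congr rfl fun i _ => ?_
    rw [metric_rankProj hc, metric_symm F (𝐞 i), mul_comm]
  simp only [residRic, residCurv_apply, map_sub, metric_smul_left, LinearMap.sub_apply,
    Finset.sum_sub_distrib, ← Finset.mul_sum, h1] at h
  rw [Ric]
  simp only [gm_eq]
  linear_combination h

lemma dOne_eta (α : Fin 3) (X Y : V) : dOne F V (et F V α) X Y = 𝐠 (𝐓 α X) Y := by
  have h1 := metric_reebDeriv_left (F := F) α Y X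
  have h2 := metric_symm F X (𝐓 α Y)
  have h3 := metric_symm F Y (𝐓 α X)
  have h : der F V X (et F V α Y) - der F V Y (et F V α X) - et F V α (lie F V X Y)
      = (2 : ℝ) • 𝐠 (𝐓 α X) Y := by
    simp only [et_eq, der_metric, lie_eq, nab_xi, map_sub, LinearMap.sub_apply, two_smul]
    linear_combination h3 - h2 - h1 + h3
  rw [dOne, h, smul_smul, inv_mul_cancel₀ two_ne_zero, one_smul]

lemma rankProj_of_InE4m (hc : cc F V ≠ 0) {X : V} (hX : InE4m F V X) : 𝐏 X = 0 := by
  have h : 𝐓 0 X = 0 := eq_zero_of_metric (F := F) fun Y => by rw [← dOne_eta, hX.2]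
  rw [reebDeriv_eq hc, neg_eq_zero] at h
  refine eq_zero_of_structMap (half_smul_inj hc h) ?_
  rw [metric_rankProj hc, rankProj_xi hc, ← et_eq, hX.1]

lemma sub_rankProj_InE4m (hc : cc F V ≠ 0) (X : V) : InE4m F V (X - 𝐏 X) := by
  refine ⟨fun α => ?_, fun α Y => ?_⟩
  · rw [et_eq, map_sub, LinearMap.sub_apply, metric_rankProj hc, rankProj_xi hc, sub_self]
  · rw [dOne_eta, reebDeriv_eq hc, map_sub, rankProj_idem hc, sub_self, map_zero, smul_zero,
      neg_zero, map_zero, LinearMap.zero_apply]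

lemma rankProj_of_InE4l (hc : cc F V ≠ 0) {X : V} (hX : InE4l F V X) : 𝐏 X = X :=
  metric_ext (F := F) fun Y => by
    have h := hX.2 _ (sub_rankProj_InE4m hc Y)
    rw [gm_eq, map_sub, sub_eq_zero] at h
    rw [metric_rankProj hc, h]

lemma rankProj_of_InE4l3 (hc : cc F V ≠ 0) {X : V} (hX : InE4l3 F V X) : 𝐏 X = X := by
  obtain ⟨Y, Z, hY, ⟨p, q, r, rfl⟩, rfl⟩ := hX
  simp only [map_add, map_smul, rankProj_of_InE4l hc hY, rankProj_xi hc]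

lemma sum_metric_rankProj (l : ℕ) [HasRank F V l] :
    ∑ i, 𝐠 (𝐏 (𝐞 i)) (𝐞 i) = algebraMap ℝ F (4 * l + 3) := by
  have hc : cc F V ≠ 0 := HasRank.c_ne l
  have hl : l ≤ dimn F V := HasRank.l_le
  have h1 : ∀ i, 𝐠 (𝐞 i) (𝐞 i) = 1 := fun i => (ACM3.frame_orth i i).trans (if_pos rfl)
  have h : ∀ i, 𝐠 (𝐏 (𝐞 i)) (𝐞 i)
      = (fun k : ℕ => if k < 4 * l ∨ 4 * dimn F V ≤ k then (1 : F) else 0) i := fun i => by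
    rcases lt_or_ge i.val (4 * l) with hi | hi
    · rw [rankProj_of_InE4l hc (HasRank.frame_E4l i hi), h1]
      exact (if_pos (Or.inl hi)).symm
    rcases lt_or_ge i.val (4 * dimn F V) with hi' | hi'
    · rw [rankProj_of_InE4m hc (HasRank.frame_E4m (l := l) i hi hi'), map_zero]
      exact (if_neg (by omega)).symm
    · rw [HasRank.frame_xi l i ⟨i.val - 4 * dimn F V, by omega⟩ (by simp; omega), rankProj_xi hc,
        metric_xi_self]
      exact (if_pos (Or.inr hi')).symm
  obtain ⟨m, hm⟩ := Nat.exists_eq_add_of_le hl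
  have h2 : ∑ k ∈ Finset.range (4 * l),
      (if k < 4 * l ∨ 4 * dimn F V ≤ k then (1 : F) else 0) = algebraMap ℝ F (4 * l) := by
    rw [Finset.sum_congr rfl fun k hk => if_pos (Or.inl (Finset.mem_range.1 hk))]
    rw [map_mul, map_natCast, map_ofNat, Finset.sum_const, Finset.card_range, nsmul_one,
      Nat.cast_mul, Nat.cast_ofNat]
  have h3 : ∑ k ∈ Finset.range (4 * m),
      (if 4 * l + k < 4 * l ∨ 4 * dimn F V ≤ 4 * l + k then (1 : F) else 0) = 0 :=
    Finset.sum_eq_zero fun k hk => if_neg (by have := Finset.mem_range.1 hk; omega)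
  have h4 : 4 * dimn F V = 4 * l + 4 * m := by omega
  rw [Finset.sum_congr rfl fun i _ => h i,
    Fin.sum_univ_eq_sum_range (fun k : ℕ => if k < 4 * l ∨ 4 * dimn F V ≤ k then (1 : F) else 0),
    Finset.sum_range_succ, Finset.sum_range_succ, Finset.sum_range_succ,
    h4, Finset.sum_range_add, ← h4, h2, h3, if_pos (by omega), if_pos (by omega),
    if_pos (by omega), map_add]
  norm_num [map_ofNat]
  ring

variable (F V) in
lemma Ric_eq_smul_metric (l : ℕ) [HasRank F V l] (X Y : V) :
    Ric F V X Y = algebraMap ℝ F (cc F V ^ 2 / 2 * (2 * (l : ℝ) + 1)) * 𝐠 (𝐏 X) Y := by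
  rw [Ric_eq (HasRank.c_ne l), sum_metric_rankProj l, ← map_one (algebraMap ℝ F), ← map_mul,
    ← map_sub, ← map_mul]
  congr 2
  ring

end ricci

end QS3

namespace QS3

/-- In a 3-quasi-Sasakian manifold of rank `4l+3` the Ricci
tensor equals `(c²/2)(2l+1) g` on `E^{4l+3}` and vanishes as soon as one of
its arguments is in `E^{4m}`; in particular the scalar curvature is the
positive constant `(c²/2)(2l+1)(4l+3)`. -/
theorem ricci_rank_4l3 (F V : Type) [CommRing F] [Algebra ℝ F] [AddCommGroup V] [Module F V]
    [SmoothSetting F V] [ACM3 F V] [ThreeQS F V] [LeviCivita F V]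
    (l : ℕ) [HasRank F V l] :
    (∀ X Y : V, InE4l3 F V X → InE4l3 F V Y →
      Ric F V X Y
        = algebraMap ℝ F (cc F V ^ 2 / 2 * (2 * (l : ℝ) + 1)) * gm F V X Y) ∧
    (∀ X Y : V, InE4m F V X → Ric F V X Y = 0) ∧
    (∀ X Y : V, InE4m F V Y → Ric F V X Y = 0) ∧
    Scal F V
      = algebraMap ℝ F
          (cc F V ^ 2 / 2 * (2 * (l : ℝ) + 1) * (4 * (l : ℝ) + 3)) ∧
    0 < cc F V ^ 2 / 2 * (2 * (l : ℝ) + 1) * (4 * (l : ℝ) + 3) := by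
  have hc : cc F V ≠ 0 := HasRank.c_ne l
  have hRic := Ric_eq_smul_metric F V l
  refine ⟨fun X Y hX _ => ?_, fun X Y hX => ?_, fun X Y hY => ?_, ?_, by positivity⟩
  · rw [hRic, rankProj_of_InE4l3 hc hX, gm_eq]
  · rw [hRic, rankProj_of_InE4m hc hX, map_zero, LinearMap.zero_apply, mul_zero]
  · rw [hRic, metric_rankProj hc, rankProj_of_InE4m hc hY, map_zero, mul_zero]
  · rw [Scal, Finset.sum_congr rfl fun i _ => hRic (fr F V i) (fr F V i), ← Finset.mul_sum,
      sum_metric_rankProj l, ← map_mul]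

end QS3
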